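/- Let μ be a probability measure on Σ × 𝕋 with marginals μ_P and μ_Φ, let κ be a Markov kernel from Σ to a standard Borel space Σ', and η a Markov kernel from 𝕋 to a standard Borel space 𝕋'. Let ν := (κ ⊗ η) ∘ μ be the probability measure on Σ' × 𝕋' obtained by applying the product kernel κ ⊗ η (acting coordinate-wise) to μ, with marginals ν_P and ν_Φ. Then the probability–phase mutual information does not increase: D_KL(ν ‖ ν_P ⊗ ν_Φ) ≤ D_KL(μ ‖ μ_P ⊗ μ_Φ). -/

import Mathlib

open MeasureTheory ProbabilityTheory Real
open scoped ENNReal NNReal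

/-- The standard probability simplex in `ℝ^D`. -/
abbrev PSimplex (D : ℕ) : Type := {p : Fin D → ℝ // p ∈ stdSimplex ℝ (Fin D)}

instance : Fact (0 < 2 * π) := ⟨Real.two_pi_pos⟩

/-- The `n`-dimensional torus `(ℝ/2πℤ)^n`. -/
abbrev Torus (n : ℕ) : Type := Fin n → AddCircle (2 * π)

open Classical in
/-- Kullback–Leibler divergence between two measures. -/
noncomputable def klDiv {α : Type*} [MeasurableSpace α] (μ ν : Measure α) : ℝ≥0∞ :=
  if μ ≪ ν ∧ Integrable (llr μ ν) μ then ENNReal.ofReal (∫ x, llr μ ν x ∂μ) else ⊤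

/-- The product kernel `κ ⊗ η` acting coordinate-wise:
`(κ ⊗ η)((p,φ), A × B) = κ(p, A) · η(φ, B)`. -/
noncomputable def prodKernel {α β γ δ : Type*} [MeasurableSpace α] [MeasurableSpace β]
    [MeasurableSpace γ] [MeasurableSpace δ]
    (κ : Kernel α γ) (η : Kernel β δ) : Kernel (α × β) (γ × δ) :=
  (κ.comap Prod.fst measurable_fst) ×ₖ (η.comap Prod.snd measurable_snd)

theorem klDiv_eq_infoTheory {α : Type*} [MeasurableSpace α] (μ ν : Measure α)
    [IsProbabilityMeasure μ] [IsProbabilityMeasure ν] :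
    klDiv μ ν = InformationTheory.klDiv μ ν := by
  rw [InformationTheory.klDiv_def, klDiv]
  simp

theorem prodKernel_eq_parallelComp {α β γ δ : Type*} [MeasurableSpace α] [MeasurableSpace β]
    [MeasurableSpace γ] [MeasurableSpace δ]
    (κ : Kernel α γ) (η : Kernel β δ) [IsMarkovKernel κ] [IsMarkovKernel η] :
    prodKernel κ η = κ ∥ₖ η := by
  ext1 x
  rw [prodKernel, Kernel.prod_apply, Kernel.parallelComp_apply, Kernel.comap_apply,
    Kernel.comap_apply]

theorem bind_parallelComp_fst {α β γ δ : Type*} [MeasurableSpace α] [MeasurableSpace β]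
    [MeasurableSpace γ] [MeasurableSpace δ] (μ : Measure (α × β))
    (κ : Kernel α γ) (η : Kernel β δ) [IsMarkovKernel κ] [IsMarkovKernel η] :
    (μ.bind ⇑(κ ∥ₖ η)).fst = μ.fst.bind ⇑κ := by
  ext s hs
  rw [Measure.fst_apply hs, Measure.bind_apply (measurable_fst hs) (Kernel.aemeasurable _),
    Measure.bind_apply hs (Kernel.aemeasurable _), Measure.fst,
    lintegral_map (Kernel.measurable_coe κ hs) measurable_fst]
  refine lintegral_congr fun x => ?_
  rw [Kernel.parallelComp_apply, ← Measure.fst_apply hs, Measure.fst_prod]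

theorem bind_parallelComp_snd {α β γ δ : Type*} [MeasurableSpace α] [MeasurableSpace β]
    [MeasurableSpace γ] [MeasurableSpace δ] (μ : Measure (α × β))
    (κ : Kernel α γ) (η : Kernel β δ) [IsMarkovKernel κ] [IsMarkovKernel η] :
    (μ.bind ⇑(κ ∥ₖ η)).snd = μ.snd.bind ⇑η := by
  ext s hs
  rw [Measure.snd_apply hs, Measure.bind_apply (measurable_snd hs) (Kernel.aemeasurable _),
    Measure.bind_apply hs (Kernel.aemeasurable _), Measure.snd,
    lintegral_map (Kernel.measurable_coe η hs) measurable_snd]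
  refine lintegral_congr fun x => ?_
  rw [Kernel.parallelComp_apply, ← Measure.snd_apply hs, Measure.snd_prod]

/-- **(C2) Monotonicity** of probability–phase mutual information under free
(geometrically incoherent, i.e. product-form) operations. -/
theorem probPhaseMI_monotone {D : ℕ} {S' T' : Type*}
    [MeasurableSpace S'] [StandardBorelSpace S']
    [MeasurableSpace T'] [StandardBorelSpace T']
    (μ : Measure (PSimplex D × Torus (D - 1))) [IsProbabilityMeasure μ]
    (κ : Kernel (PSimplex D) S') [IsMarkovKernel κ]
    (η : Kernel (Torus (D - 1)) T') [IsMarkovKernel η] :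
    klDiv (μ.bind ⇑(prodKernel κ η))
        ((μ.bind ⇑(prodKernel κ η)).fst.prod ((μ.bind ⇑(prodKernel κ η)).snd))
      ≤ klDiv μ (μ.fst.prod μ.snd) := by
  rw [prodKernel_eq_parallelComp]
  have h : (μ.bind ⇑(κ ∥ₖ η)).fst.prod (μ.bind ⇑(κ ∥ₖ η)).snd
      = (μ.fst.prod μ.snd).bind ⇑(κ ∥ₖ η) := by
    rw [bind_parallelComp_fst, bind_parallelComp_snd, Measure.prod_comp_left,
      Measure.prod_comp_right, Measure.comp_assoc, Kernel.parallelComp_comp_parallelComp,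
      Kernel.comp_id, Kernel.id_comp]
  rw [h, klDiv_eq_infoTheory, klDiv_eq_infoTheory]
  exact InformationTheory.klDiv_comp_right_le _ _ _
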